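/- Define, for complex z ∉ (−∞, 0] with z ≠ 1 and using principal branches, H(z) = √z − ζ′(1/2)/(π·ζ(1/2)) + 1/(√z·(z²−1)) − 1/(2z−2) + ((log(8π)+γ₀)/π)·1/(z+1) − (2/π)·(√z/(z+1))·arctan(1/√z). Then for every such z, H(z) = −H(1/z). -/

import Mathlib

open scoped Real

/-- The function `H(z)` of the paper. -/
noncomputable def HFun (z : ℂ) : ℂ :=
  z ^ ((1 : ℂ)/2) - deriv riemannZeta (1/2) / ((π : ℂ) * riemannZeta (1/2))
    + 1 / (z ^ ((1 : ℂ)/2) * (z ^ 2 - 1)) - 1 / (2 * z - 2)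
    + ((Real.log (8 * π) + Real.eulerMascheroniConstant : ℝ) / (π : ℂ)) * (1 / (z + 1))
    - (2 / (π : ℂ)) * (z ^ ((1 : ℂ)/2) / (z + 1)) * Complex.arctan (1 / z ^ ((1 : ℂ)/2))

open MeasureTheory Set Filter Topology Asymptotics in
/-- The Mellin transform of the fractional part, cut off below `1`, converges and is holomorphic on
`re s < 0`. -/
lemma mellin_fract_differentiableAt {s : ℂ} (hs : s.re < 0) :
    MellinConvergent (indicator (Ioi 1) fun t : ℝ ↦ ((Int.fract t : ℝ) : ℂ)) s ∧
      DifferentiableAt ℂ (mellin (indicator (Ioi 1) fun t : ℝ ↦ ((Int.fract t : ℝ) : ℂ))) s := by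
  have hmeas : Measurable (indicator (Ioi 1) fun t : ℝ ↦ ((Int.fract t : ℝ) : ℂ)) :=
    (Complex.measurable_ofReal.comp measurable_fract).indicator measurableSet_Ioi
  have hbound (t : ℝ) : ‖indicator (Ioi 1) (fun t : ℝ ↦ ((Int.fract t : ℝ) : ℂ)) t‖ ≤ 1 := by
    refine (norm_indicator_le_norm_self _ _).trans ?_
    rw [Complex.norm_real, Real.norm_of_nonneg (Int.fract_nonneg t)]
    exact (Int.fract_lt_one t).le
  have hloc : LocallyIntegrableOn
      (indicator (Ioi 1) fun t : ℝ ↦ ((Int.fract t : ℝ) : ℂ)) (Ioi 0) :=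
    ((locallyIntegrable_const (1 : ℝ)).mono hmeas.aestronglyMeasurable
      (.of_forall fun t ↦ by simpa using hbound t)).locallyIntegrableOn _
  have htop : (indicator (Ioi 1) fun t : ℝ ↦ ((Int.fract t : ℝ) : ℂ))
      =O[atTop] (· ^ (-(0 : ℝ))) := by
    refine .of_bound 1 (.of_forall fun t ↦ ?_)
    simpa using hbound t
  have hbot : (indicator (Ioi 1) fun t : ℝ ↦ ((Int.fract t : ℝ) : ℂ))
      =O[𝓝[>] 0] (· ^ (-(s.re - 1))) := by
    refine EventuallyEq.trans_isBigO ?_ (isBigO_zero _ _)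
    filter_upwards [nhdsWithin_le_nhds (Iio_mem_nhds zero_lt_one)] with t ht
    exact indicator_of_notMem (not_lt.mpr (mem_Iio.mp ht).le) _
  exact ⟨mellinConvergent_of_isBigO_rpow hloc htop hs hbot (sub_one_lt _),
    mellin_differentiableAt_of_isBigO_rpow hloc htop hs hbot (sub_one_lt _)⟩

open MeasureTheory Set Filter Topology Asymptotics in
lemma riemannZeta_eq_sub_mul_mellin_fract {s : ℂ} (hs : 1 < s.re) :
    riemannZeta s = s / (s - 1)
      - s * mellin (indicator (Ioi 1) fun t : ℝ ↦ ((Int.fract t : ℝ) : ℂ)) (-s) := by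
  have hO : (fun n : ℕ ↦ ∑ k ∈ Finset.Icc 1 n, (1 : ℕ → ℂ) k) =O[atTop]
      fun n ↦ (n : ℝ) ^ (1 : ℝ) := by
    refine .of_bound 1 (.of_forall fun n ↦ ?_)
    simp
  rw [← LSeries_one_eq_riemannZeta hs, LSeries_eq_mul_integral 1 zero_le_one hs
    (LSeriesSummable_one_iff.mpr hs) hO, div_eq_mul_one_div, ← mul_sub]
  congr 1
  have hconv := (mellin_fract_differentiableAt (s := -s) (by simp; linarith)).1
  have hfun : (fun t : ℝ ↦ (t : ℂ) ^ (-s - 1) •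
      indicator (Ioi 1) (fun t : ℝ ↦ ((Int.fract t : ℝ) : ℂ)) t) =
      indicator (Ioi 1) fun t : ℝ ↦ (t : ℂ) ^ (-s - 1) * ((Int.fract t : ℝ) : ℂ) := by
    ext t
    by_cases ht : t ∈ Ioi (1 : ℝ) <;> simp [ht]
  have hsub : Ioi (1 : ℝ) ⊆ Ioi 0 := Ioi_subset_Ioi zero_le_one
  rw [MellinConvergent, hfun, integrableOn_indicator_iff measurableSet_Ioi,
    inter_eq_left.mpr hsub] at hconv
  rw [mellin, hfun, setIntegral_indicator measurableSet_Ioi, inter_eq_right.mpr hsub]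
  have hint : ∫ t : ℝ in Ioi 1, (t : ℂ) ^ (-s) = 1 / (s - 1) := by
    rw [integral_Ioi_cpow_of_lt (by simpa using hs) zero_lt_one, Complex.ofReal_one,
      Complex.one_cpow, show -s + 1 = -(s - 1) by ring, neg_div_neg_eq]
  rw [← hint, ← integral_sub (integrableOn_Ioi_cpow_of_lt (by simpa using hs) zero_lt_one) hconv]
  refine setIntegral_congr_fun measurableSet_Ioi fun t (ht : 1 < t) ↦ ?_
  have ht0 : (t : ℂ) ≠ 0 := by exact_mod_cast (zero_lt_one.trans ht).ne'
  have hfloor : ((⌊t⌋₊ : ℝ) : ℂ) = t - (Int.fract t : ℝ) := by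
    rw [natCast_floor_eq_intCast_floor (zero_le_one.trans ht.le), Int.fract]
    push_cast
    ring
  have hp : (t : ℂ) ^ (-s) = t ^ (-s - 1) * t := by
    rw [Complex.cpow_sub _ _ ht0, Complex.cpow_one, div_mul_cancel₀ _ ht0]
  simp only [Pi.one_apply, Finset.sum_const, Nat.card_Icc, add_tsub_cancel_right, nsmul_eq_mul,
    mul_one]
  rw [← Complex.ofReal_natCast, hfloor, hp, neg_add, ← sub_eq_add_neg]
  ring

open Set Filter Topology in
/-- On `0 < re s`, `(s - 1) ζ(s)` has the representation coming from Abel summation. -/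
lemma riemannZeta₁_eq_mellin_fract {s : ℂ} (hs : 0 < s.re) :
    riemannZeta₁ s = s - s * (s - 1)
      * mellin (indicator (Ioi 1) fun t : ℝ ↦ ((Int.fract t : ℝ) : ℂ)) (-s) := by
  have hopen : IsOpen {s : ℂ | 0 < s.re} := isOpen_lt continuous_const Complex.continuous_re
  have hdiff : DifferentiableOn ℂ (fun s : ℂ ↦ s - s * (s - 1)
      * mellin (indicator (Ioi 1) fun t : ℝ ↦ ((Int.fract t : ℝ) : ℂ)) (-s)) {s | 0 < s.re} := by
    intro w hw
    have hm := (mellin_fract_differentiableAt (s := -w) (by simpa using hw)).2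
    have hc := hm.comp w (differentiable_neg.differentiableAt (x := w))
    have hp : DifferentiableAt ℂ (fun s : ℂ ↦ s * (s - 1)) w := by fun_prop
    exact (differentiableAt_id.sub (hp.mul hc)).differentiableWithinAt
  refine (differentiable_riemannZeta₁.differentiableOn.analyticOnNhd hopen)
    |>.eqOn_of_preconnected_of_eventuallyEq (hdiff.analyticOnNhd hopen)
    (convex_halfSpace_re_gt 0).isPreconnected (z₀ := 2) (by simp) ?_ hs
  have h2 : {s : ℂ | 1 < s.re} ∈ 𝓝 (2 : ℂ) :=
    (isOpen_lt continuous_const Complex.continuous_re).mem_nhds (by simp)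
  filter_upwards [h2] with w hw
  have hw1 : w ≠ 1 := by
    rintro rfl
    simp at hw
  have hw' : w - 1 ≠ 0 := sub_ne_zero.mpr hw1
  have h := riemannZeta_eq_sub_mul_mellin_fract hw
  rw [riemannZeta_eq_inv_sub_mul hw1] at h
  field_simp at h
  linear_combination h

open MeasureTheory Set in
lemma riemannZeta_one_half_ne_zero : riemannZeta (1 / 2) ≠ 0 := by
  rw [riemannZeta_eq_inv_sub_mul (by norm_num)]
  refine mul_ne_zero (by norm_num) fun h ↦ ?_
  rw [riemannZeta₁_eq_mellin_fract (by norm_num)] at h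
  have hreal : mellin (indicator (Ioi 1) fun t : ℝ ↦ ((Int.fract t : ℝ) : ℂ)) (-(1 / 2)) =
      ((∫ t : ℝ in Ioi 0, t ^ (-(1 / 2) - 1 : ℝ) * indicator (Ioi 1) Int.fract t : ℝ) : ℂ) := by
    rw [mellin, ← integral_complex_ofReal]
    refine setIntegral_congr_fun measurableSet_Ioi fun t (ht : 0 < t) ↦ ?_
    by_cases ht1 : t ∈ Ioi (1 : ℝ) <;> simp [ht1, Complex.ofReal_cpow ht.le]
  have hnonneg : 0 ≤ ∫ t : ℝ in Ioi 0, t ^ (-(1 / 2) - 1 : ℝ) * indicator (Ioi 1) Int.fract t :=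
    setIntegral_nonneg measurableSet_Ioi fun t (ht : 0 < t) ↦
      mul_nonneg (Real.rpow_nonneg ht.le _) (indicator_nonneg (fun _ _ ↦ Int.fract_nonneg _) t)
  rw [hreal] at h
  set M := ∫ t : ℝ in Ioi 0, t ^ (-(1 / 2) - 1 : ℝ) * indicator (Ioi 1) Int.fract t
  have h' : (1 / 2 - 1 / 2 * (1 / 2 - 1) * M : ℝ) = 0 := by
    apply Complex.ofReal_injective
    push_cast
    exact h
  linarith

/-- The logarithmic derivative of the functional equation at the central point. -/
lemma deriv_riemannZeta_one_half_div :
    deriv riemannZeta (1 / 2) / riemannZeta (1 / 2) =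
      (Complex.log (2 * π) + 2 * Complex.log 2 + Real.eulerMascheroniConstant + π / 2) / 2 := by
  have hζ := riemannZeta_one_half_ne_zero
  have hpole (n : ℕ) : (1 / 2 : ℂ) ≠ -n := by
    intro h
    have := congrArg Complex.re h
    have hn : (0 : ℝ) ≤ n := n.cast_nonneg
    norm_num at this
    linarith
  have h2π : (2 * π : ℂ) ≠ 0 := mul_ne_zero two_ne_zero (by exact_mod_cast Real.pi_ne_zero)
  have hev : (fun s ↦ riemannZeta (1 - s)) =ᶠ[nhds (1 / 2)] fun s ↦
      2 * (2 * π : ℂ) ^ (-s) * Complex.Gamma s * Complex.cos (π * s / 2) * riemannZeta s := by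
    have hre : {s : ℂ | 0 < s.re} ∈ nhds (1 / 2 : ℂ) :=
      (isOpen_lt continuous_const Complex.continuous_re).mem_nhds (by norm_num)
    filter_upwards [hre, isOpen_ne.mem_nhds (show (1 / 2 : ℂ) ≠ 1 by norm_num)] with s hs hs1
    refine riemannZeta_one_sub (fun n hn ↦ ?_) hs1
    rw [hn] at hs
    have : (0 : ℝ) ≤ n := n.cast_nonneg
    simp at hs
    linarith
  have hd : HasDerivAt riemannZeta (deriv riemannZeta (1 / 2)) (1 / 2) :=
    (differentiableAt_riemannZeta (by norm_num)).hasDerivAt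
  have hlhs : HasDerivAt (fun s ↦ riemannZeta (1 - s)) (deriv riemannZeta (1 / 2) * (-1))
      (1 / 2) := by
    refine HasDerivAt.comp (1 / 2) (h₂ := riemannZeta) ?_ ((hasDerivAt_id _).const_sub 1)
    norm_num
    simpa using hd
  have hpow : HasDerivAt (fun s : ℂ ↦ 2 * (2 * π : ℂ) ^ (-s))
      (2 * ((2 * π : ℂ) ^ (-(1 / 2) : ℂ) * Complex.log (2 * π) * (-1))) (1 / 2) :=
    ((hasDerivAt_neg (1 / 2 : ℂ)).const_cpow (.inl h2π)).const_mul 2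
  have hΓ : HasDerivAt Complex.Gamma (Complex.Gamma (1 / 2) *
      (-2 * Complex.log 2 - Real.eulerMascheroniConstant)) (1 / 2) := by
    refine (Complex.differentiableAt_Gamma _ hpole).hasDerivAt.congr_deriv ?_
    rw [← Complex.digamma_one_half, Complex.digamma_def, logDeriv_apply,
      mul_div_cancel₀ _ (Complex.Gamma_ne_zero hpole)]
  have hcos : HasDerivAt (fun s : ℂ ↦ Complex.cos (π * s / 2))
      (Complex.cos (π * (1 / 2) / 2) * (-(π / 2))) (1 / 2) := by
    have hlin : HasDerivAt (fun s : ℂ ↦ π * s / 2) (π * 1 / 2) (1 / 2 : ℂ) :=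
      ((hasDerivAt_id _).const_mul _).div_const 2
    refine hlin.ccos.congr_deriv ?_
    have hsc : Complex.sin (π * (1 / 2) / 2) = Complex.cos (π * (1 / 2) / 2) := by
      rw [← Complex.cos_pi_div_two_sub]
      congr 1
      ring
    rw [hsc]
    ring
  have hderiv := (((hpow.mul hΓ).mul hcos).mul hd).congr_of_eventuallyEq hev |>.unique hlhs
  have hval := hev.eq_of_nhds
  rw [show (1 - 1 / 2 : ℂ) = 1 / 2 by norm_num] at hval
  simp only [Pi.mul_apply] at hderiv
  rw [div_eq_div_iff hζ two_ne_zero]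
  set P := (2 * π : ℂ) ^ (-(1 / 2) : ℂ)
  set G := Complex.Gamma (1 / 2)
  set C := Complex.cos (π * (1 / 2) / 2)
  have hone : 2 * P * G * C = 1 := mul_right_cancel₀ hζ (by rw [← hval, one_mul])
  linear_combination hderiv - (deriv riemannZeta (1 / 2) - riemannZeta (1 / 2) *
    (Complex.log (2 * π) + 2 * Complex.log 2 + Real.eulerMascheroniConstant + π / 2)) * hone

lemma Complex.arctan_add_arctan_inv {w : ℂ} (hw : 0 < w.re) :
    arctan w + arctan (1 / w) = π / 2 := by
  have hw0 : w ≠ 0 := by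
    rintro rfl
    simp at hw
  have hp : 1 + w * I ≠ 0 := fun h ↦ by
    have := congrArg im h
    simp at this
    linarith
  have hm : 1 - w * I ≠ 0 := fun h ↦ by
    have := congrArg im h
    simp at this
    linarith
  set u := (1 + w * I) / (1 - w * I) with hu
  have him : 0 < u.im := by
    have hN : 0 < normSq (1 - w * I) := normSq_pos.mpr hm
    have : u.im = 2 * w.re / normSq (1 - w * I) := by
      rw [hu, div_im]
      simp
      field_simp
      ring
    rw [this]
    positivity
  have hinv : (1 + 1 / w * I) / (1 - 1 / w * I) = (-u)⁻¹ := by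
    have hwI : w - I ≠ 0 := fun h ↦ hp (by linear_combination I * h + I_mul_I)
    have hm' : 1 - 1 / w * I ≠ 0 := by
      rw [show 1 - 1 / w * I = (w - I) / w by field_simp]
      exact div_ne_zero hwI hw0
    rw [hu, ← neg_div, inv_div, div_eq_div_iff hm' (neg_ne_zero.mpr hp)]
    field_simp
    linear_combination (-2 * w) * I_sq
  have harg : (-u).arg ≠ π := fun h ↦ by
    have := (arg_eq_pi_iff.mp h).2
    simp at this
    linarith
  have hlog : log (-u) = log u - π * I := by
    simp only [log, norm_neg, arg_neg_eq_arg_sub_pi_of_im_pos him]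
    push_cast
    ring
  rw [arctan, arctan, hinv, log_inv _ harg, hlog, ← hu]
  linear_combination (-(π : ℂ) / 2) * I_sq

theorem HFun_antisymm (z : ℂ) (hz : z ∈ Complex.slitPlane) (hz1 : z ≠ 1) :
    HFun z = -HFun (1 / z) := by
  have hz0 : z ≠ 0 := Complex.slitPlane_ne_zero hz
  have harg : z.arg ≠ π := (Complex.mem_slitPlane_iff_arg.mp hz).1
  have hinv : (1 / z) ^ ((1 : ℂ) / 2) = 1 / z ^ ((1 : ℂ) / 2) := by
    rw [one_div z, Complex.inv_cpow _ _ harg, one_div (z ^ _)]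
  have hsq : (z ^ ((1 : ℂ) / 2)) ^ 2 = z := by
    rw [← Complex.cpow_nat_mul]
    norm_num
  have hre : 0 < (z ^ ((1 : ℂ) / 2)).re := by
    rw [Complex.cpow_def_of_ne_zero hz0, Complex.exp_re]
    refine mul_pos (Real.exp_pos _) (Real.cos_pos_of_mem_Ioo ?_)
    have h1 := Complex.neg_pi_lt_arg z
    have h2 := (Complex.arg_le_pi z).lt_of_ne harg
    have him : (Complex.log z * (1 / 2)).im = z.arg / 2 := by
      rw [Complex.mul_im, Complex.log_im]
      norm_num
      ring
    rw [him]
    constructor <;> linarith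
  have harctan := Complex.arctan_add_arctan_inv hre
  have hlog : Complex.log (2 * π) + 2 * Complex.log 2 = (Real.log (8 * π) : ℝ) := by
    have h : Real.log (2 * π) + 2 * Real.log 2 = Real.log (8 * π) := by
      rw [show (8 * π : ℝ) = 2 * π * 2 ^ 2 by ring,
        Real.log_mul (x := 2 * π) (by positivity) (by positivity), Real.log_pow]
      push_cast
      ring
    rw [← h]
    push_cast [Complex.ofReal_log Real.two_pi_pos.le]
    simp
  have hζ := deriv_riemannZeta_one_half_div
  rw [hlog] at hζ
  have hπ : (π : ℂ) ≠ 0 := by exact_mod_cast Real.pi_ne_zero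
  have hz1' : z - 1 ≠ 0 := sub_ne_zero.mpr hz1
  have hz2 : z + 1 ≠ 0 := fun h ↦ by
    rw [eq_neg_of_add_eq_zero_left h] at hz
    simp [Complex.mem_slitPlane_iff] at hz
    linarith
  unfold HFun
  rw [hinv, one_div_one_div]
  rw [mul_comm (π : ℂ), ← div_div, hζ]
  generalize z ^ ((1 : ℂ) / 2) = w at *
  subst hsq
  rw [eq_sub_of_add_eq' harctan]
  have hw0 : w ≠ 0 := by
    rintro rfl
    simp at hre
  have h4 : (w ^ 2) ^ 2 - 1 ≠ 0 := by
    rw [show (w ^ 2) ^ 2 - 1 = (w ^ 2 - 1) * (w ^ 2 + 1) by ring]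
    exact mul_ne_zero hz1' hz2
  have e1 : 1 / (1 / w * ((1 / w ^ 2) ^ 2 - 1)) = - w ^ 5 / ((w ^ 2 - 1) * (w ^ 2 + 1)) := by
    rw [show 1 / w * ((1 / w ^ 2) ^ 2 - 1) = -((w ^ 2 - 1) * (w ^ 2 + 1)) / w ^ 5 by
      field_simp; ring, one_div_div, neg_div, div_neg]
  have e2 : 1 / (2 * (1 / w ^ 2) - 2) = - w ^ 2 / (2 * (w ^ 2 - 1)) := by
    rw [show 2 * (1 / w ^ 2) - 2 = -(2 * (w ^ 2 - 1)) / w ^ 2 by field_simp; ring, one_div_div,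
      neg_div, div_neg]
  have e3 : 1 / w ^ 2 + 1 = (w ^ 2 + 1) / w ^ 2 := by
    field_simp
    ring
  rw [e1, e2, e3, show (w ^ 2) ^ 2 - 1 = (w ^ 2 - 1) * (w ^ 2 + 1) by ring,
    show 2 * w ^ 2 - 2 = 2 * (w ^ 2 - 1) by ring]
  push_cast
  field_simp
  ring
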